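/- Let 𝒳 be a nonempty finite set, p_X a probability mass function on 𝒳, Δ : 𝒳 × 𝒳 → [0,∞) a distortion measure, and c : 𝒳 × 𝒳 → [0,∞) a cost function inducing the divergence φ. For D ≥ 0 and P ≥ 0, define R(D,P) as the infimum of I(X;U) over all probability mass functions p on 𝒳 × ℕ × 𝒳 for a triple (X, U, X̂) such that: the X-marginal of p is p_X; the Markov chain condition p(x,u,x̂)·p_U(u) = p_{XU}(x,u)·p_{UX̂}(u,x̂) holds for all (x,u,x̂); ∑_{x,u,x̂} p(x,u,x̂)·Δ(x,x̂) ≤ D; and ∑_{u : p_U(u)>0} p_U(u)·φ(p_{X|U}(·|u), p_{X̂|U}(·|u)) ≤ P. Then R(D,P) is convex in (D,P) on [0,∞)²: for all (D₀,P₀), (D₁,P₁) ∈ [0,∞)² and λ ∈ [0,1], R((1−λ)D₀ + λD₁, (1−λ)P₀ + λP₁) ≤ (1−λ)·R(D₀,P₀) + λ·R(D₁,P₁). -/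

import Mathlib

open Finset

/-- `p` is a probability mass function on the finite type `α`. -/
def IsPMF {α : Type*} [Fintype α] (p : α → ℝ) : Prop :=
  (∀ a, 0 ≤ p a) ∧ ∑ a, p a = 1

/-- `π` is a coupling of the pmfs `p` and `q`. -/
def IsCoupling {α : Type*} [Fintype α] (p q : α → ℝ) (π : α × α → ℝ) : Prop :=
  IsPMF π ∧ (∀ a, ∑ b, π (a, b) = p a) ∧ (∀ b, ∑ a, π (a, b) = q b)

/-- The single-letter transport divergence `φ(p,q)` induced by the cost `c`. -/
noncomputable def transportCost1 {𝒳 : Type*} [Fintype 𝒳] (c : 𝒳 → 𝒳 → ℝ)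
    (p q : 𝒳 → ℝ) : ℝ :=
  sInf { v | ∃ π : 𝒳 × 𝒳 → ℝ, IsCoupling p q π ∧ v = ∑ z : 𝒳 × 𝒳, π z * c z.1 z.2 }

section RDP

variable {𝒳 : Type*} [Fintype 𝒳]

/-- The `U`-marginal of a pmf on `𝒳 × ℕ × 𝒳`. -/
noncomputable def margU (p : 𝒳 × ℕ × 𝒳 → ℝ) (u : ℕ) : ℝ :=
  ∑ x, ∑ y, p (x, u, y)

/-- The `(X,U)`-marginal of a pmf on `𝒳 × ℕ × 𝒳`. -/
noncomputable def margXU (p : 𝒳 × ℕ × 𝒳 → ℝ) (x : 𝒳) (u : ℕ) : ℝ :=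
  ∑ y, p (x, u, y)

/-- The `(U,X̂)`-marginal of a pmf on `𝒳 × ℕ × 𝒳`. -/
noncomputable def margUXhat (p : 𝒳 × ℕ × 𝒳 → ℝ) (u : ℕ) (y : 𝒳) : ℝ :=
  ∑ x, p (x, u, y)

/-- The `X`-marginal of a pmf on `𝒳 × ℕ × 𝒳`. -/
noncomputable def margX (p : 𝒳 × ℕ × 𝒳 → ℝ) (x : 𝒳) : ℝ :=
  ∑' u : ℕ, ∑ y, p (x, u, y)

/-- The mutual information `I(X;U)` of a pmf on `𝒳 × ℕ × 𝒳` (natural logarithm). -/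
noncomputable def mutualInfoXU (p : 𝒳 × ℕ × 𝒳 → ℝ) : ℝ :=
  ∑' u : ℕ, ∑ x : 𝒳,
    if 0 < margXU p x u then
      margXU p x u * Real.log (margXU p x u / (margX p x * margU p u))
    else 0

/-- The informational rate-distortion-perception function `R(D,P)` with the
conditional-distribution-based perception measure. -/
noncomputable def RDP (pX : 𝒳 → ℝ) (Δ : 𝒳 → 𝒳 → ℝ) (c : 𝒳 → 𝒳 → ℝ) (D P : ℝ) : ℝ :=
  sInf { v | ∃ p : 𝒳 × ℕ × 𝒳 → ℝ,
    (∀ z, 0 ≤ p z) ∧ (∑' z : 𝒳 × ℕ × 𝒳, p z) = 1 ∧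
    (∀ x, margX p x = pX x) ∧
    (∀ x u y, p (x, u, y) * margU p u = margXU p x u * margUXhat p u y) ∧
    (∑' z : 𝒳 × ℕ × 𝒳, p z * Δ z.1 z.2.2) ≤ D ∧
    (∑' u : ℕ, if 0 < margU p u then
        margU p u * transportCost1 c (fun x => margXU p x u / margU p u)
          (fun y => margUXhat p u y / margU p u)
      else 0) ≤ P ∧
    v = mutualInfoXU p }

section TransportCost

variable {c : 𝒳 → 𝒳 → ℝ} {q r : 𝒳 → ℝ}

lemma sum_coupling_mul_nonneg (hc0 : ∀ x y, 0 ≤ c x y) {π : 𝒳 × 𝒳 → ℝ}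
    (hπ : IsCoupling q r π) : 0 ≤ ∑ z : 𝒳 × 𝒳, π z * c z.1 z.2 :=
  Finset.sum_nonneg fun z _ => mul_nonneg (hπ.1.1 z) (hc0 _ _)

lemma transportCost1_nonneg (hc0 : ∀ x y, 0 ≤ c x y) : 0 ≤ transportCost1 c q r := by
  refine Real.sInf_nonneg ?_
  rintro v ⟨π, hπ, rfl⟩
  exact sum_coupling_mul_nonneg hc0 hπ

lemma transportCost1_le_of_isCoupling (hc0 : ∀ x y, 0 ≤ c x y) {π : 𝒳 × 𝒳 → ℝ}
    (hπ : IsCoupling q r π) : transportCost1 c q r ≤ ∑ z : 𝒳 × 𝒳, π z * c z.1 z.2 := by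
  refine csInf_le ⟨0, ?_⟩ ⟨π, hπ, rfl⟩
  rintro v ⟨π', hπ', rfl⟩
  exact sum_coupling_mul_nonneg hc0 hπ'

lemma isCoupling_prod (hq : IsPMF q) (hr : IsPMF r) :
    IsCoupling q r fun z => q z.1 * r z.2 := by
  refine ⟨⟨fun z => mul_nonneg (hq.1 _) (hr.1 _), ?_⟩, fun a => ?_, fun b => ?_⟩
  · rw [Fintype.sum_prod_type]
    simp [← Finset.mul_sum, hq.2, hr.2]
  · simp [← Finset.mul_sum, hr.2]
  · simp [← Finset.sum_mul, hq.2]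

lemma IsPMF.le_one (hq : IsPMF q) (x : 𝒳) : q x ≤ 1 :=
  hq.2 ▸ Finset.single_le_sum (fun i _ => hq.1 i) (Finset.mem_univ x)

lemma transportCost1_le_sum (hc0 : ∀ x y, 0 ≤ c x y) (hq : IsPMF q) (hr : IsPMF r) :
    transportCost1 c q r ≤ ∑ z : 𝒳 × 𝒳, c z.1 z.2 :=
  (transportCost1_le_of_isCoupling hc0 (isCoupling_prod hq hr)).trans <|
    Finset.sum_le_sum fun _ _ => mul_le_of_le_one_left (hc0 _ _)
      (mul_le_one₀ (hq.le_one _) (hr.1 _) (hr.le_one _))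

lemma transportCost1_self (hc0 : ∀ x y, 0 ≤ c x y) (hc : ∀ x, c x x = 0) (hq : IsPMF q) :
    transportCost1 c q q = 0 := by
  classical
  have hπ : IsCoupling q q fun z => if z.1 = z.2 then q z.1 else 0 := by
    refine ⟨⟨fun z => ?_, ?_⟩, fun a => ?_, fun b => ?_⟩
    · dsimp only
      split_ifs
      exacts [hq.1 _, le_rfl]
    · rw [Fintype.sum_prod_type]
      simp [hq.2]
    · simp
    · simp
  refine le_antisymm ((transportCost1_le_of_isCoupling hc0 hπ).trans_eq ?_)
    (transportCost1_nonneg hc0)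
  refine Finset.sum_eq_zero fun z _ => ?_
  split_ifs with h
  · rw [h, hc, mul_zero]
  · rw [zero_mul]

end TransportCost

/-- The contribution of `u` to the conditional perception measure. -/
noncomputable def perceptionTerm (c : 𝒳 → 𝒳 → ℝ) (p : 𝒳 × ℕ × 𝒳 → ℝ) (u : ℕ) : ℝ :=
  if 0 < margU p u then
    margU p u * transportCost1 c (fun x => margXU p x u / margU p u)
      (fun y => margUXhat p u y / margU p u)
  else 0

/-- The contribution of `u` to the mutual information, relative to a reference pmf `q`. -/
noncomputable def infoTerm (q : 𝒳 → ℝ) (p : 𝒳 × ℕ × 𝒳 → ℝ) (u : ℕ) : ℝ :=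
  ∑ x : 𝒳, if 0 < margXU p x u then
    margXU p x u * Real.log (margXU p x u / (q x * margU p u)) else 0

/-- The constraints in the definition of `RDP`. -/
structure IsFeasible (pX : 𝒳 → ℝ) (Δ c : 𝒳 → 𝒳 → ℝ) (D P : ℝ) (p : 𝒳 × ℕ × 𝒳 → ℝ) :
    Prop where
  nonneg : ∀ z, 0 ≤ p z
  tsum_eq_one : ∑' z, p z = 1
  margX_eq : ∀ x, margX p x = pX x
  markov : ∀ x u y, p (x, u, y) * margU p u = margXU p x u * margUXhat p u y
  distortion_le : ∑' z, p z * Δ z.1 z.2.2 ≤ D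
  perception_le : ∑' u, perceptionTerm c p u ≤ P

lemma RDP_eq_sInf_image (pX : 𝒳 → ℝ) (Δ c : 𝒳 → 𝒳 → ℝ) (D P : ℝ) :
    RDP pX Δ c D P = sInf (mutualInfoXU '' {p | IsFeasible pX Δ c D P p}) := by
  unfold RDP
  congr 1
  ext v
  constructor
  · rintro ⟨p, h1, h2, h3, h4, h5, h6, rfl⟩
    exact ⟨p, ⟨h1, h2, h3, h4, h5, h6⟩, rfl⟩
  · rintro ⟨p, ⟨h1, h2, h3, h4, h5, h6⟩, rfl⟩
    exact ⟨p, h1, h2, h3, h4, h5, h6, rfl⟩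

section Marginals

variable {p : 𝒳 × ℕ × 𝒳 → ℝ}

lemma sum_margXU (p : 𝒳 × ℕ × 𝒳 → ℝ) (u : ℕ) : ∑ x, margXU p x u = margU p u := rfl

lemma sum_margUXhat (p : 𝒳 × ℕ × 𝒳 → ℝ) (u : ℕ) : ∑ y, margUXhat p u y = margU p u :=
  Finset.sum_comm

lemma margXU_nonneg (hp : ∀ z, 0 ≤ p z) (x : 𝒳) (u : ℕ) : 0 ≤ margXU p x u :=
  Finset.sum_nonneg fun _ _ => hp _

lemma margUXhat_nonneg (hp : ∀ z, 0 ≤ p z) (u : ℕ) (y : 𝒳) : 0 ≤ margUXhat p u y :=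
  Finset.sum_nonneg fun _ _ => hp _

lemma margXU_le_margU (hp : ∀ z, 0 ≤ p z) (x : 𝒳) (u : ℕ) : margXU p x u ≤ margU p u :=
  Finset.single_le_sum (f := fun x => margXU p x u) (fun _ _ => margXU_nonneg hp _ _)
    (Finset.mem_univ x)

lemma isPMF_margXU_div {u : ℕ} (hp : ∀ z, 0 ≤ p z) (hu : 0 < margU p u) :
    IsPMF fun x => margXU p x u / margU p u :=
  ⟨fun x => div_nonneg (margXU_nonneg hp x u) hu.le, by
    rw [← Finset.sum_div, sum_margXU, div_self hu.ne']⟩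

lemma isPMF_margUXhat_div {u : ℕ} (hp : ∀ z, 0 ≤ p z) (hu : 0 < margU p u) :
    IsPMF fun y => margUXhat p u y / margU p u :=
  ⟨fun y => div_nonneg (margUXhat_nonneg hp u y) hu.le, by
    rw [← Finset.sum_div, sum_margUXhat, div_self hu.ne']⟩

lemma summable_margXU (hs : Summable p) (x : 𝒳) : Summable (margXU p x) :=
  summable_sum fun y _ => hs.comp_injective (i := fun u : ℕ => (x, u, y)) fun a b h => by
    simpa using h

lemma summable_margU (hs : Summable p) : Summable (margU p) :=
  summable_sum fun x _ => summable_margXU hs x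

lemma margXU_le_margX (hp : ∀ z, 0 ≤ p z) (hs : Summable p) (x : 𝒳) (u : ℕ) :
    margXU p x u ≤ margX p x :=
  (summable_margXU hs x).le_tsum u fun _ _ => margXU_nonneg hp _ _

lemma perceptionTerm_nonneg {c : 𝒳 → 𝒳 → ℝ} (hc0 : ∀ x y, 0 ≤ c x y) (u : ℕ) :
    0 ≤ perceptionTerm c p u := by
  unfold perceptionTerm
  split_ifs with h
  · exact mul_nonneg h.le (transportCost1_nonneg hc0)
  · exact le_rfl

lemma summable_perceptionTerm {c : 𝒳 → 𝒳 → ℝ} (hc0 : ∀ x y, 0 ≤ c x y) (hp : ∀ z, 0 ≤ p z)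
    (hs : Summable p) : Summable (perceptionTerm c p) := by
  refine Summable.of_nonneg_of_le (perceptionTerm_nonneg hc0) (fun u => ?_)
    ((summable_margU hs).mul_right (∑ z : 𝒳 × 𝒳, c z.1 z.2))
  unfold perceptionTerm
  split_ifs with h
  · exact mul_le_mul_of_nonneg_left
      (transportCost1_le_sum hc0 (isPMF_margXU_div hp h) (isPMF_margUXhat_div hp h)) h.le
  · exact mul_nonneg (Finset.sum_nonneg fun x _ => margXU_nonneg hp x u)
      (Finset.sum_nonneg fun _ _ => hc0 _ _)

lemma infoTerm_nonneg {q : 𝒳 → ℝ} {u : ℕ} (hp : ∀ z, 0 ≤ p z) (hq : IsPMF q)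
    (hpq : ∀ x, margXU p x u ≤ q x) : 0 ≤ infoTerm q p u := by
  have hU : 0 ≤ margU p u := Finset.sum_nonneg fun x _ => margXU_nonneg hp x u
  have key : ∑ x, (margXU p x u - q x * margU p u) ≤ infoTerm q p u := by
    refine Finset.sum_le_sum fun x _ => ?_
    split_ifs with h
    · have hqx : 0 < q x * margU p u :=
        mul_pos (h.trans_le (hpq x)) (h.trans_le (margXU_le_margU hp x u))
      have hlog := mul_le_mul_of_nonneg_left (Real.one_sub_inv_le_log_of_pos (div_pos h hqx)) h.le
      refine le_trans (le_of_eq ?_) hlog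
      field_simp
    · have := mul_nonneg (hq.1 x) hU
      linarith
  rwa [Finset.sum_sub_distrib, sum_margXU, ← Finset.sum_mul, hq.2, one_mul, sub_self] at key

lemma infoTerm_le {q : 𝒳 → ℝ} {u : ℕ} (hp : ∀ z, 0 ≤ p z)
    (hpq : ∀ x, margXU p x u ≤ q x) :
    infoTerm q p u ≤ ∑ x, margXU p x u * |Real.log (q x)⁻¹| := by
  refine Finset.sum_le_sum fun x _ => ?_
  split_ifs with h
  · have hqx : 0 < q x := h.trans_le (hpq x)
    have hU : 0 < margU p u := h.trans_le (margXU_le_margU hp x u)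
    refine mul_le_mul_of_nonneg_left (le_trans ?_ (le_abs_self _)) h.le
    refine Real.log_le_log (div_pos h (mul_pos hqx hU)) ?_
    rw [div_le_iff₀ (mul_pos hqx hU), inv_mul_cancel_left₀ hqx.ne']
    exact margXU_le_margU hp x u
  · exact mul_nonneg (margXU_nonneg hp x u) (abs_nonneg _)

/-- If a slice of `p` is a nonnegative multiple of a slice of `p'`, then all single-slice
functionals scale accordingly. -/
lemma slice_smul {p' : 𝒳 × ℕ × 𝒳 → ℝ} {u v : ℕ} {a : ℝ}
    (h : ∀ x y, p (x, u, y) = a * p' (x, v, y)) :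
    margU p u = a * margU p' v ∧ (∀ x, margXU p x u = a * margXU p' x v) ∧
      ∀ y, margUXhat p u y = a * margUXhat p' v y := by
  simp [margU, margXU, margUXhat, h, Finset.mul_sum]

lemma perceptionTerm_smul {c : 𝒳 → 𝒳 → ℝ} {p' : 𝒳 × ℕ × 𝒳 → ℝ} {u v : ℕ} {a : ℝ} (ha : 0 ≤ a)
    (h : ∀ x y, p (x, u, y) = a * p' (x, v, y)) :
    perceptionTerm c p u = a * perceptionTerm c p' v := by
  obtain ⟨h1, h2, h3⟩ := slice_smul h
  rcases ha.eq_or_lt with rfl | ha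
  · simp [perceptionTerm, h1]
  · simp only [perceptionTerm, h1, h2, h3, mul_pos_iff_of_pos_left ha,
      mul_div_mul_left _ _ ha.ne', mul_ite, mul_zero, mul_assoc]

lemma infoTerm_smul {q : 𝒳 → ℝ} {p' : 𝒳 × ℕ × 𝒳 → ℝ} {u v : ℕ} {a : ℝ} (ha : 0 ≤ a)
    (h : ∀ x y, p (x, u, y) = a * p' (x, v, y)) :
    infoTerm q p u = a * infoTerm q p' v := by
  obtain ⟨h1, h2, -⟩ := slice_smul h
  rcases ha.eq_or_lt with rfl | ha
  · simp [infoTerm, h2]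
  · simp only [infoTerm, h1, h2, mul_pos_iff_of_pos_left ha, mul_left_comm _ a,
      mul_div_mul_left _ _ ha.ne', mul_ite, mul_zero, mul_assoc, Finset.mul_sum]

end Marginals

section Feasible

variable {pX : 𝒳 → ℝ} {Δ c : 𝒳 → 𝒳 → ℝ} {D P : ℝ} {p : 𝒳 × ℕ × 𝒳 → ℝ}

namespace IsFeasible

lemma summable (h : IsFeasible pX Δ c D P p) : Summable p := by
  by_contra hs
  have := h.tsum_eq_one
  rw [tsum_eq_zero_of_not_summable hs] at this
  exact zero_ne_one this

lemma margXU_le (h : IsFeasible pX Δ c D P p) (x : 𝒳) (u : ℕ) : margXU p x u ≤ pX x :=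
  h.margX_eq x ▸ margXU_le_margX h.nonneg h.summable x u

lemma mutualInfoXU_eq (h : IsFeasible pX Δ c D P p) :
    mutualInfoXU p = ∑' u, infoTerm pX p u := by
  simp only [mutualInfoXU, infoTerm, h.margX_eq]

lemma hasSum_infoTerm (h : IsFeasible pX Δ c D P p) (hpX : IsPMF pX) :
    HasSum (infoTerm pX p) (mutualInfoXU p) := by
  rw [h.mutualInfoXU_eq]
  refine Summable.hasSum (Summable.of_nonneg_of_le
    (fun u => infoTerm_nonneg h.nonneg hpX fun x => h.margXU_le x u)
    (fun u => infoTerm_le h.nonneg fun x => h.margXU_le x u) ?_)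
  exact summable_sum fun x _ => (summable_margXU h.summable x).mul_right _

lemma mutualInfoXU_nonneg (h : IsFeasible pX Δ c D P p) (hpX : IsPMF pX) :
    0 ≤ mutualInfoXU p :=
  (h.hasSum_infoTerm hpX).nonneg fun u => infoTerm_nonneg h.nonneg hpX fun x => h.margXU_le x u

lemma hasSum_margXU (h : IsFeasible pX Δ c D P p) (x : 𝒳) : HasSum (margXU p x) (pX x) :=
  h.margX_eq x ▸ (summable_margXU h.summable x).hasSum

lemma summable_mul_distortion (h : IsFeasible pX Δ c D P p) (hΔ0 : ∀ x y, 0 ≤ Δ x y) :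
    Summable fun z : 𝒳 × ℕ × 𝒳 => p z * Δ z.1 z.2.2 := by
  refine Summable.of_nonneg_of_le (fun z => mul_nonneg (h.nonneg z) (hΔ0 _ _)) (fun z => ?_)
    (h.summable.mul_right (∑ w : 𝒳 × 𝒳, Δ w.1 w.2))
  exact mul_le_mul_of_nonneg_left
    (Finset.single_le_sum (f := fun w : 𝒳 × 𝒳 => Δ w.1 w.2) (fun _ _ => hΔ0 _ _)
      (Finset.mem_univ (z.1, z.2.2))) (h.nonneg z)

end IsFeasible

/-- Full disclosure of the source, `U = X` and `X̂ = X`, is feasible for every `D, P ≥ 0`. -/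
lemma exists_isFeasible (hpX : IsPMF pX) (hΔ : ∀ x, Δ x x = 0) (hc0 : ∀ x y, 0 ≤ c x y)
    (hc : ∀ x, c x x = 0) (hD : 0 ≤ D) (hP : 0 ≤ P) : ∃ p, IsFeasible pX Δ c D P p := by
  classical
  obtain ⟨e, he⟩ : ∃ e : 𝒳 → ℕ, Function.Injective e :=
    ⟨fun x => Fintype.equivFin 𝒳 x, Fin.val_injective.comp (Fintype.equivFin 𝒳).injective⟩
  let p : 𝒳 × ℕ × 𝒳 → ℝ := fun z => if z.1 = z.2.2 ∧ z.2.1 = e z.1 then pX z.1 else 0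
  have hp0 : ∀ z, 0 ≤ p z := fun z => by
    dsimp only [p]
    split_ifs
    exacts [hpX.1 _, le_rfl]
  have hXU : ∀ x u, margXU p x u = if u = e x then pX x else 0 := fun x u => by
    simp [margXU, p, ite_and]
  have hUX : ∀ u y, margUXhat p u y = if u = e y then pX y else 0 := fun u y => by
    simp [margUXhat, p, ite_and]
  have hU : ∀ x, margU p (e x) = pX x := fun x => by
    rw [← sum_margXU]
    simp [hXU, he.eq_iff]
  refine ⟨p, hp0, ?_, fun x => ?_, fun x u y => ?_, ?_, ?_⟩
  · have hinj : Function.Injective fun x : 𝒳 => (x, e x, x) := fun a b h => (Prod.ext_iff.1 h).1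
    refine ((hinj.hasSum_iff fun z hz => ?_).1 ?_).tsum_eq
    · refine if_neg fun h => hz ⟨z.1, ?_⟩
      ext1
      · rfl
      · ext1
        exacts [h.2.symm, h.1]
    · convert hasSum_fintype pX using 1
      · ext x
        simp [p]
      · exact hpX.2.symm
  · change ∑' u, margXU p x u = _
    simp [hXU]
  · rw [hXU, hUX]
    by_cases hu : u = e x
    · subst hu
      rw [hU]
      by_cases hxy : x = y
      · subst hxy
        simp [p]
      · simp [p, hxy, he.eq_iff]
    · simp [p, hu]
  · refine (tsum_nonpos fun z => ?_).trans hD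
    dsimp only [p]
    split_ifs with h
    · rw [← h.1, hΔ, mul_zero]
    · rw [zero_mul]
  · refine (tsum_nonpos fun u => ?_).trans hP
    unfold perceptionTerm
    split_ifs with h
    · have hsymm : (fun y => margUXhat p u y / margU p u) = fun x => margXU p x u / margU p u := by
        ext x
        rw [hXU, hUX]
      rw [hsymm, transportCost1_self hc0 hc (isPMF_margXU_div hp0 h), mul_zero]
    · exact le_rfl

end Feasible

/-- Time sharing between `p₀` (weight `a`, even values of `u`) and `p₁` (weight `b`, odd values
of `u`). -/
noncomputable def timeShare {α β : Type*} (a b : ℝ) (p₀ p₁ : α × ℕ × β → ℝ) (z : α × ℕ × β) : ℝ :=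
  if Even z.2.1 then a * p₀ (z.1, z.2.1 / 2, z.2.2) else b * p₁ (z.1, z.2.1 / 2, z.2.2)

lemma timeShare_even {α β : Type*} {a b : ℝ} {p₀ p₁ : α × ℕ × β → ℝ}
    (x : α) (u : ℕ) (y : β) :
    timeShare a b p₀ p₁ (x, 2 * u, y) = a * p₀ (x, u, y) := by
  simp [timeShare]

lemma timeShare_odd {α β : Type*} {a b : ℝ} {p₀ p₁ : α × ℕ × β → ℝ}
    (x : α) (u : ℕ) (y : β) :
    timeShare a b p₀ p₁ (x, 2 * u + 1, y) = b * p₁ (x, u, y) := by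
  have : (2 * u + 1) / 2 = u := by omega
  simp [timeShare, this]

lemma HasSum.even_add_odd_middle {α β : Type*} {f : α × ℕ × β → ℝ} {m m' : ℝ}
    (h₀ : HasSum (fun z : α × ℕ × β => f (z.1, 2 * z.2.1, z.2.2)) m)
    (h₁ : HasSum (fun z : α × ℕ × β => f (z.1, 2 * z.2.1 + 1, z.2.2)) m') :
    HasSum f (m + m') := by
  have i₀ : Function.Injective fun z : α × ℕ × β => (z.1, 2 * z.2.1, z.2.2) := by
    rintro ⟨a, n, b⟩ ⟨a', n', b'⟩ h
    simpa using h
  have i₁ : Function.Injective fun z : α × ℕ × β => (z.1, 2 * z.2.1 + 1, z.2.2) := by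
    rintro ⟨a, n, b⟩ ⟨a', n', b'⟩ h
    simpa using h
  refine HasSum.add_isCompl ?_ (i₀.hasSum_range_iff.2 h₀) (i₁.hasSum_range_iff.2 h₁)
  refine ⟨Set.disjoint_left.2 ?_, codisjoint_iff_le_sup.2 ?_⟩
  · rintro _ ⟨z, rfl⟩ ⟨w, hw⟩
    simp only [Prod.mk.injEq] at hw
    omega
  · rintro ⟨x, u, y⟩ -
    obtain ⟨k, rfl | rfl⟩ := Nat.even_or_odd' u
    · exact Or.inl ⟨(x, k, y), rfl⟩
    · exact Or.inr ⟨(x, k, y), rfl⟩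

section TimeShare

variable {a b : ℝ} {p₀ p₁ : 𝒳 × ℕ × 𝒳 → ℝ}
  {pX : 𝒳 → ℝ} {Δ c : 𝒳 → 𝒳 → ℝ} {D₀ P₀ D₁ P₁ : ℝ}

lemma IsFeasible.timeShare (hΔ0 : ∀ x y, 0 ≤ Δ x y) (hc0 : ∀ x y, 0 ≤ c x y)
    (ha : 0 ≤ a) (hb : 0 ≤ b) (hab : a + b = 1)
    (h₀ : IsFeasible pX Δ c D₀ P₀ p₀) (h₁ : IsFeasible pX Δ c D₁ P₁ p₁) :
    IsFeasible pX Δ c (a * D₀ + b * D₁) (a * P₀ + b * P₁) (timeShare a b p₀ p₁) where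
  nonneg z := by
    unfold _root_.timeShare
    split_ifs
    exacts [mul_nonneg ha (h₀.nonneg _), mul_nonneg hb (h₁.nonneg _)]
  tsum_eq_one := by
    have s₀ := h₀.summable.hasSum.mul_left a
    have s₁ := h₁.summable.hasSum.mul_left b
    rw [h₀.tsum_eq_one, mul_one] at s₀
    rw [h₁.tsum_eq_one, mul_one] at s₁
    rw [← hab]
    refine (HasSum.even_add_odd_middle ?_ ?_).tsum_eq
    · simpa only [timeShare_even] using s₀
    · simpa only [timeShare_odd] using s₁
  margX_eq x := by
    rw [← one_mul (pX x), ← hab, add_mul]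
    refine (HasSum.even_add_odd ?_ ?_).tsum_eq
    · simpa only [timeShare_even, margXU, ← Finset.mul_sum] using (h₀.hasSum_margXU x).mul_left a
    · simpa only [timeShare_odd, margXU, ← Finset.mul_sum] using (h₁.hasSum_margXU x).mul_left b
  markov x u y := by
    obtain ⟨k, rfl | rfl⟩ := Nat.even_or_odd' u
    · obtain ⟨e₁, e₂, e₃⟩ := slice_smul fun x y => timeShare_even (a := a) (b := b) (p₀ := p₀)
        (p₁ := p₁) x k y
      rw [e₁, e₂, e₃, timeShare_even]
      linear_combination a ^ 2 * h₀.markov x k y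
    · obtain ⟨e₁, e₂, e₃⟩ := slice_smul fun x y => timeShare_odd (a := a) (b := b) (p₀ := p₀)
        (p₁ := p₁) x k y
      rw [e₁, e₂, e₃, timeShare_odd]
      linear_combination b ^ 2 * h₁.markov x k y
  distortion_le := by
    refine ((HasSum.even_add_odd_middle ?_ ?_).tsum_eq).trans_le (add_le_add
      (mul_le_mul_of_nonneg_left h₀.distortion_le ha)
      (mul_le_mul_of_nonneg_left h₁.distortion_le hb))
    · simpa only [timeShare_even, mul_assoc] using
        (h₀.summable_mul_distortion hΔ0).hasSum.mul_left a
    · simpa only [timeShare_odd, mul_assoc] using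
        (h₁.summable_mul_distortion hΔ0).hasSum.mul_left b
  perception_le := by
    refine ((HasSum.even_add_odd ?_ ?_).tsum_eq).trans_le (add_le_add
      (mul_le_mul_of_nonneg_left h₀.perception_le ha)
      (mul_le_mul_of_nonneg_left h₁.perception_le hb))
    · simpa only [perceptionTerm_smul ha fun x y => timeShare_even x _ y] using
        (summable_perceptionTerm hc0 h₀.nonneg h₀.summable).hasSum.mul_left a
    · simpa only [perceptionTerm_smul hb fun x y => timeShare_odd x _ y] using
        (summable_perceptionTerm hc0 h₁.nonneg h₁.summable).hasSum.mul_left b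

lemma mutualInfoXU_timeShare (hpX : IsPMF pX) (hΔ0 : ∀ x y, 0 ≤ Δ x y)
    (hc0 : ∀ x y, 0 ≤ c x y) (ha : 0 ≤ a) (hb : 0 ≤ b) (hab : a + b = 1)
    (h₀ : IsFeasible pX Δ c D₀ P₀ p₀) (h₁ : IsFeasible pX Δ c D₁ P₁ p₁) :
    mutualInfoXU (timeShare a b p₀ p₁) = a * mutualInfoXU p₀ + b * mutualInfoXU p₁ := by
  rw [(h₀.timeShare hΔ0 hc0 ha hb hab h₁).mutualInfoXU_eq]
  refine (HasSum.even_add_odd ?_ ?_).tsum_eq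
  · simpa only [infoTerm_smul ha fun x y => timeShare_even x _ y] using
      (h₀.hasSum_infoTerm hpX).mul_left a
  · simpa only [infoTerm_smul hb fun x y => timeShare_odd x _ y] using
      (h₁.hasSum_infoTerm hpX).mul_left b

end TimeShare

/-- Convexity of the informational RDP function `R(D,P)` in `(D,P)` on `[0,∞)²`. -/
theorem RDP_convex [Nonempty 𝒳] (pX : 𝒳 → ℝ) (hpX : IsPMF pX)
    (Δ : 𝒳 → 𝒳 → ℝ) (hΔ0 : ∀ x y, 0 ≤ Δ x y) (hΔz : ∀ x y, Δ x y = 0 ↔ x = y)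
    (c : 𝒳 → 𝒳 → ℝ) (hc0 : ∀ x y, 0 ≤ c x y) (hcz : ∀ x y, c x y = 0 ↔ x = y)
    (D₀ P₀ D₁ P₁ : ℝ) (hD₀ : 0 ≤ D₀) (hP₀ : 0 ≤ P₀) (hD₁ : 0 ≤ D₁) (hP₁ : 0 ≤ P₁)
    (lam : ℝ) (hlam0 : 0 ≤ lam) (hlam1 : lam ≤ 1) :
    RDP pX Δ c ((1 - lam) * D₀ + lam * D₁) ((1 - lam) * P₀ + lam * P₁) ≤
      (1 - lam) * RDP pX Δ c D₀ P₀ + lam * RDP pX Δ c D₁ P₁ := by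
  set a := 1 - lam
  have ha : 0 ≤ a := sub_nonneg.2 hlam1
  have hab : a + lam = 1 := sub_add_cancel 1 lam
  have hne {D P : ℝ} (hD : 0 ≤ D) (hP : 0 ≤ P) :
      (mutualInfoXU '' {p | IsFeasible pX Δ c D P p}).Nonempty :=
    Set.Nonempty.image _ (exists_isFeasible hpX (fun x => (hΔz x x).2 rfl) hc0
      (fun x => (hcz x x).2 rfl) hD hP)
  have hle {p₀ p₁ : 𝒳 × ℕ × 𝒳 → ℝ} (h₀ : IsFeasible pX Δ c D₀ P₀ p₀)
      (h₁ : IsFeasible pX Δ c D₁ P₁ p₁) :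
      RDP pX Δ c (a * D₀ + lam * D₁) (a * P₀ + lam * P₁) ≤
        a * mutualInfoXU p₀ + lam * mutualInfoXU p₁ := by
    rw [← mutualInfoXU_timeShare hpX hΔ0 hc0 ha hlam0 hab h₀ h₁, RDP_eq_sInf_image]
    refine csInf_le ⟨0, ?_⟩ ⟨_, h₀.timeShare hΔ0 hc0 ha hlam0 hab h₁, rfl⟩
    rintro v ⟨p, hp, rfl⟩
    exact IsFeasible.mutualInfoXU_nonneg hp hpX
  refine le_of_forall_pos_le_add fun ε hε => ?_
  obtain ⟨-, ⟨p₀, h₀, rfl⟩, l₀⟩ := Real.lt_sInf_add_pos (hne hD₀ hP₀) hε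
  obtain ⟨-, ⟨p₁, h₁, rfl⟩, l₁⟩ := Real.lt_sInf_add_pos (hne hD₁ hP₁) hε
  rw [← RDP_eq_sInf_image] at l₀ l₁
  refine (hle h₀ h₁).trans ?_
  have := mul_le_mul_of_nonneg_left l₀.le ha
  have := mul_le_mul_of_nonneg_left l₁.le hlam0
  linear_combination this + mul_le_mul_of_nonneg_left l₀.le ha + ε * hab

end RDP
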